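/- arXiv:1406.7457 — 2 statements merged into one kernel-verified Lean document; each statement's English description precedes it below -/
import Mathlib

section
/- Let k ≥ 3 be an integer and let τ ∈ Σ_{K,b} satisfy div τ = 0 identically on ℝ². Then there exists w ∈ P_{k−4} (so w = 0 if k = 3) such that, setting W := w · (λ₀λ₁λ₂)², one has τ₁₁ = ∂²W/∂y², τ₁₂ = τ₂₁ = −∂²W/∂x∂y, and τ₂₂ = ∂²W/∂x² identically on ℝ². -/
open MeasureTheory

noncomputable section

/-- For a column vector `v ∈ ℝ²`, `vvT v` is the rank-one symmetric matrix `v vᵀ`. -/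
def vvT (v : Fin 2 → ℝ) : Matrix (Fin 2) (Fin 2) ℝ :=
  Matrix.of fun i j => v i * v j

/-- For `n = (a, b)`, `perp n = (−b, a)`. -/
def perp (n : Fin 2 → ℝ) : Fin 2 → ℝ := ![-(n 1), n 0]

/-- Frobenius inner product `A : B` of 2×2 matrices. -/
def frob (A B : Matrix (Fin 2) (Fin 2) ℝ) : ℝ :=
  ∑ i : Fin 2, ∑ j : Fin 2, A i j * B i j

/-- Partial derivative in the `i`-th coordinate direction. -/
def pd (i : Fin 2) (f : (Fin 2 → ℝ) → ℝ) : (Fin 2 → ℝ) → ℝ :=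
  fun x => fderiv ℝ f x (Pi.single i 1)

/-- Row-wise divergence of a matrix field: `(div τ)_i = ∂τ_{i1}/∂x + ∂τ_{i2}/∂y`. -/
def matDiv (τ : (Fin 2 → ℝ) → Matrix (Fin 2) (Fin 2) ℝ) : (Fin 2 → ℝ) → Fin 2 → ℝ :=
  fun x i => pd 0 (fun y => τ y i 0) x + pd 1 (fun y => τ y i 1) x

/-- Symmetric gradient `ε(v) = (Dv + (Dv)ᵀ)/2` of a vector field. -/
def symGrad (v : (Fin 2 → ℝ) → Fin 2 → ℝ) : (Fin 2 → ℝ) → Matrix (Fin 2) (Fin 2) ℝ :=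
  fun x => Matrix.of fun i j => (pd j (fun y => v y i) x + pd i (fun y => v y j) x) / 2

/-- A rigid motion `(x, y) ↦ (a − by, c + bx)`. -/
def IsRigidMotion (r : (Fin 2 → ℝ) → Fin 2 → ℝ) : Prop :=
  ∃ a b c : ℝ, ∀ x, r x = ![a - b * x 1, c + b * x 0]

/-- `f : ℝ² → ℝ` is a polynomial function of total degree at most `m`
(the zero space when `m < 0`). -/
def IsPolyDeg (m : ℤ) (f : (Fin 2 → ℝ) → ℝ) : Prop :=
  ∃ p : MvPolynomial (Fin 2) ℝ, (∀ x, f x = MvPolynomial.eval x p) ∧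
    ((p.totalDegree : ℤ) ≤ m ∨ p = 0)

/-- `f : ℝ² → ℝ` is an affine function. -/
def IsAffineFn (f : (Fin 2 → ℝ) → ℝ) : Prop :=
  ∃ (w : Fin 2 → ℝ) (c : ℝ), ∀ x, f x = w 0 * x 0 + w 1 * x 1 + c

/-- The triangle `K` with the given vertices. -/
def Ktri (x0 x1 x2 : Fin 2 → ℝ) : Set (Fin 2 → ℝ) :=
  convexHull ℝ {x0, x1, x2}

/-- The matrix whose columns are `x1 − x0` and `x2 − x0`. -/
def Bmat (x0 x1 x2 : Fin 2 → ℝ) : Matrix (Fin 2) (Fin 2) ℝ :=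
  Matrix.of fun i j => if j = 0 then x1 i - x0 i else x2 i - x0 i

/-- `nvec x0 x1 x2 1` and `nvec x0 x1 x2 2` are the rows of `(Bmat x0 x1 x2)⁻¹`,
and `nvec x0 x1 x2 0 = −n₁ − n₂`. -/
def nvec (x0 x1 x2 : Fin 2 → ℝ) : Fin 3 → Fin 2 → ℝ :=
  ![fun j => -((Bmat x0 x1 x2)⁻¹ 0 j) - (Bmat x0 x1 x2)⁻¹ 1 j,
    fun j => (Bmat x0 x1 x2)⁻¹ 0 j,
    fun j => (Bmat x0 x1 x2)⁻¹ 1 j]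

/-- The bubble stress `λ₂λ₀ p₁ n₁⊥(n₁⊥)ᵀ + λ₀λ₁ p₂ n₂⊥(n₂⊥)ᵀ + λ₁λ₂ p₀ n₀⊥(n₀⊥)ᵀ`. -/
def bubbleStress (x0 x1 x2 : Fin 2 → ℝ) (lam : Fin 3 → (Fin 2 → ℝ) → ℝ)
    (p : Fin 3 → (Fin 2 → ℝ) → ℝ) : (Fin 2 → ℝ) → Matrix (Fin 2) (Fin 2) ℝ :=
  fun x => (lam 2 x * lam 0 x * p 1 x) • vvT (perp (nvec x0 x1 x2 1))
         + (lam 0 x * lam 1 x * p 2 x) • vvT (perp (nvec x0 x1 x2 2))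
         + (lam 1 x * lam 2 x * p 0 x) • vvT (perp (nvec x0 x1 x2 0))

/-- Membership in the local bubble stress space `Σ_{K,b}` of order `k`. -/
def SigmaKb (k : ℕ) (x0 x1 x2 : Fin 2 → ℝ) (lam : Fin 3 → (Fin 2 → ℝ) → ℝ)
    (τ : (Fin 2 → ℝ) → Matrix (Fin 2) (Fin 2) ℝ) : Prop :=
  ∃ p : Fin 3 → (Fin 2 → ℝ) → ℝ,
    (∀ i, IsPolyDeg ((k : ℤ) - 2) (p i)) ∧ τ = bubbleStress x0 x1 x2 lam p

open MvPolynomial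

/-- Termwise antiderivative of a polynomial in the variable `X i`. -/
def antideriv (i : Fin 2) :
    MvPolynomial (Fin 2) ℝ →ₗ[ℝ] MvPolynomial (Fin 2) ℝ :=
  (basisMonomials (Fin 2) ℝ).constr ℝ
    fun m => monomial (m + Finsupp.single i 1) ((m i + 1 : ℝ)⁻¹)

theorem antideriv_monomial (i : Fin 2) (m : Fin 2 →₀ ℕ) (a : ℝ) :
    antideriv i (monomial m a) = monomial (m + Finsupp.single i 1) (a / (m i + 1)) := by
  have h : antideriv i (monomial m 1) = monomial (m + Finsupp.single i 1) ((m i + 1 : ℝ)⁻¹) := by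
    have := (basisMonomials (Fin 2) ℝ).constr_basis ℝ
      (fun m : Fin 2 →₀ ℕ => monomial (m + Finsupp.single i 1) ((m i + 1 : ℝ)⁻¹)) m
    simpa [antideriv, coe_basisMonomials] using this
  have h2 : monomial m a = a • monomial m (1 : ℝ) := by simp [smul_monomial]
  rw [h2, map_smul, h, smul_monomial, smul_eq_mul, div_eq_mul_inv]

theorem pderiv_antideriv (i : Fin 2) (p : MvPolynomial (Fin 2) ℝ) :
    pderiv i (antideriv i p) = p := by
  induction p using MvPolynomial.induction_on' with
  | monomial m a =>
    have : (m i + 1 : ℝ) ≠ 0 := by positivity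
    simp [antideriv_monomial, pderiv_monomial, this]
  | add p q hp hq => simp only [map_add, hp, hq]

theorem antideriv_pderiv_of_dvd (i : Fin 2) {p : MvPolynomial (Fin 2) ℝ} (h : X i ∣ p) :
    antideriv i (pderiv i p) = p := by
  obtain ⟨q, rfl⟩ := h
  induction q using MvPolynomial.induction_on' with
  | monomial m a =>
    have : (m i + 1 : ℝ) ≠ 0 := by positivity
    rw [X, monomial_mul, pderiv_monomial, antideriv_monomial]
    have e : Finsupp.single i 1 + m - Finsupp.single i 1 = m := by simp
    rw [e, add_comm m]
    congr 1
    simp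
    field_simp
    ring
  | add p q hp hq => simp only [mul_add, map_add, hp, hq]

theorem antideriv_X_mul_of_ne {i j : Fin 2} (hij : j ≠ i) (p : MvPolynomial (Fin 2) ℝ) :
    antideriv i (X j * p) = X j * antideriv i p := by
  induction p using MvPolynomial.induction_on' with
  | monomial m a =>
    simp only [X, monomial_mul, antideriv_monomial]
    congr 1
    · rw [add_assoc]
    · simp [hij]
  | add p q hp hq => simp only [mul_add, map_add, hp, hq]

theorem sq_dvd_antideriv (i : Fin 2) (p : MvPolynomial (Fin 2) ℝ) :
    X i ^ 2 ∣ antideriv i (X i * p) := by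
  induction p using MvPolynomial.induction_on' with
  | monomial m a =>
    refine ⟨monomial m (a / (m i + 2)), ?_⟩
    simp only [X, sq, monomial_mul, antideriv_monomial]
    congr 1
    · rw [add_right_comm]
    · simp; ring
  | add p q hp hq => simp only [mul_add, map_add]; exact dvd_add hp hq

theorem pderiv_antideriv_of_ne {i j : Fin 2} (hij : j ≠ i) (p : MvPolynomial (Fin 2) ℝ) :
    pderiv j (antideriv i p) = antideriv i (pderiv j p) := by
  induction p using MvPolynomial.induction_on' with
  | monomial m a =>
    simp only [pderiv_monomial, antideriv_monomial]
    by_cases hm : m j = 0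
    · simp [hm, hij]
    · congr 1
      · congr 1
        ext l
        by_cases hl : l = j
        · simp [hl, hij]
        · simp [hl]
      · simp [hij]; ring
  | add p q hp hq => simp only [map_add, hp, hq]

theorem totalDegree_antideriv_le (i : Fin 2) (p : MvPolynomial (Fin 2) ℝ) :
    (antideriv i p).totalDegree ≤ p.totalDegree + 1 := by
  conv_lhs => rw [p.as_sum, map_sum]
  refine totalDegree_finsetSum_le fun m hm => ?_
  rw [antideriv_monomial]
  refine (totalDegree_monomial_le _ _).trans ?_
  have := le_totalDegree hm
  rw [Finsupp.sum_add_index' (by simp) (by simp)]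
  simpa [Function.id_def] using this

/-- The barycentric coordinate vanishing on the hypotenuse of the reference triangle. -/
def hypotenuse : MvPolynomial (Fin 2) ℝ := 1 - X 0 - X 1

/-- Restriction of a bivariate polynomial to the line `X 0 + X 1 = 1`. -/
def lineRestrict : MvPolynomial (Fin 2) ℝ →ₐ[ℝ] Polynomial ℝ :=
  aeval ![Polynomial.X, 1 - Polynomial.X]

theorem hypotenuse_ne_zero : hypotenuse ≠ 0 := fun h => by
  simpa [hypotenuse] using congrArg (eval 0) h

theorem totalDegree_hypotenuse : hypotenuse.totalDegree = 1 := by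
  apply le_antisymm
  · refine (totalDegree_sub _ _).trans (max_le ((totalDegree_sub _ _).trans ?_) ?_) <;> simp
  · rw [Nat.one_le_iff_ne_zero]
    intro h
    rw [totalDegree_eq_zero_iff_eq_C] at h
    have h0 := congrArg (eval 0) h
    have h1 := congrArg (eval (Pi.single 0 1)) h
    simp only [eval_C] at h0 h1
    rw [← h0] at h1
    simp [hypotenuse] at h1

theorem hypotenuse_dvd_iff {p : MvPolynomial (Fin 2) ℝ} :
    hypotenuse ∣ p ↔ lineRestrict p = 0 := by
  constructor
  · rintro ⟨q, rfl⟩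
    simp [hypotenuse, lineRestrict]
  · intro h
    rw [← Ideal.mem_span_singleton, ← Ideal.Quotient.eq_zero_iff_mem]
    let I := Ideal.span {hypotenuse}
    let g : Polynomial ℝ →ₐ[ℝ] MvPolynomial (Fin 2) ℝ ⧸ I :=
      Polynomial.aeval (Ideal.Quotient.mk I (X 0))
    have hg : g.comp lineRestrict = Ideal.Quotient.mkₐ ℝ I := by
      ext i
      fin_cases i
      · simp [g, lineRestrict]
      · simp only [g, lineRestrict, I]
        simp
        rw [← map_one (Ideal.Quotient.mk _), ← map_sub, Ideal.Quotient.eq,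
          Ideal.mem_span_singleton, hypotenuse]
    have := congrArg (fun f => f p) hg
    simpa [h] using this.symm

theorem derivative_lineRestrict (p : MvPolynomial (Fin 2) ℝ) :
    (lineRestrict p).derivative = lineRestrict (pderiv 0 p - pderiv 1 p) := by
  induction p using MvPolynomial.induction_on with
  | C a => simp [lineRestrict]
  | add p q hp hq => simp only [map_add, hp, hq, map_sub]; ring
  | mul_X p i hp =>
    simp only [map_mul, Polynomial.derivative_mul, hp, pderiv_mul, map_sub, map_add]
    fin_cases i <;> simp [lineRestrict, pderiv_X] <;> ring

theorem hypotenuse_dvd_of_dvd_pderiv_sub {p : MvPolynomial (Fin 2) ℝ}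
    (h0 : eval ![0, 1] p = 0)
    (h : hypotenuse ∣ pderiv 0 p - pderiv 1 p) : hypotenuse ∣ p := by
  rw [hypotenuse_dvd_iff] at h ⊢
  rw [← derivative_lineRestrict] at h
  have hc := Polynomial.eq_C_of_derivative_eq_zero h
  have he : (lineRestrict p).eval 0 = eval ![0, 1] p := by
    rw [← Polynomial.coe_aeval_eq_eval, ← MvPolynomial.coe_aeval_eq_eval]
    change ((Polynomial.aeval (0 : ℝ)).comp lineRestrict) p = aeval ![(0 : ℝ), 1] p
    congr 1
    ext i
    fin_cases i <;> simp [lineRestrict]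
  rw [hc, Polynomial.coeff_zero_eq_eval_zero, he, h0, map_zero]

theorem hypotenuse_dvd_of_dvd_sq_mul {p : MvPolynomial (Fin 2) ℝ}
    (h : hypotenuse ∣ X 0 ^ 2 * X 1 ^ 2 * p) : hypotenuse ∣ p := by
  rw [hypotenuse_dvd_iff] at h ⊢
  have h1 : (1 - Polynomial.X : Polynomial ℝ) ≠ 0 := fun h => by
    simpa using congrArg (Polynomial.eval 0) h
  simpa [lineRestrict, h1] using h

theorem hypotenuse_sq_dvd {W : MvPolynomial (Fin 2) ℝ} (h : hypotenuse ∣ W)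
    (h0 : hypotenuse ∣ pderiv 0 W) : hypotenuse ^ 2 ∣ W := by
  obtain ⟨Z, rfl⟩ := h
  rw [pderiv_mul, dvd_add_left (dvd_mul_right _ _)] at h0
  have : pderiv 0 hypotenuse = -1 := by simp [hypotenuse, pderiv_X]
  rw [this, neg_one_mul, dvd_neg] at h0
  rw [sq]
  exact mul_dvd_mul_left _ h0

/-- The Airy potential of a divergence-free bubble stress in reference coordinates is a
multiple of the squared cubic bubble. -/
theorem exists_airy_potential {P : Fin 3 → MvPolynomial (Fin 2) ℝ}
    {A B D : MvPolynomial (Fin 2) ℝ} (hA : A = X 1 * hypotenuse * P 1 + B)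
    (hB : B = X 0 * X 1 * P 0) (hD : D = hypotenuse * X 0 * P 2 + B)
    (h1 : pderiv 1 A = pderiv 0 B) (h2 : pderiv 1 B = pderiv 0 D) :
    ∃ w : MvPolynomial (Fin 2) ℝ, (w = 0 ∨ w.totalDegree + 2 ≤ (P 0).totalDegree) ∧
      pderiv 0 (pderiv 0 (w * (hypotenuse * X 0 * X 1) ^ 2)) = A ∧
      pderiv 0 (pderiv 1 (w * (hypotenuse * X 0 * X 1) ^ 2)) = B ∧
      pderiv 1 (pderiv 0 (w * (hypotenuse * X 0 * X 1) ^ 2)) = B ∧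
      pderiv 1 (pderiv 1 (w * (hypotenuse * X 0 * X 1) ^ 2)) = D := by
  have n01 : (0 : Fin 2) ≠ 1 := by decide
  have dA : pderiv 0 (antideriv 1 B) = A := by
    rw [pderiv_antideriv_of_ne n01, ← h1, antideriv_pderiv_of_dvd]
    exact ⟨hypotenuse * P 1 + X 0 * P 0, by rw [hA, hB]; ring⟩
  have dD : pderiv 1 (antideriv 0 B) = D := by
    rw [pderiv_antideriv_of_ne n01.symm, h2, antideriv_pderiv_of_dvd]
    exact ⟨hypotenuse * P 2 + X 1 * P 0, by rw [hD, hB]; ring⟩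
  obtain ⟨W, hW0, hW1, q, hq, hdeg⟩ : ∃ W, pderiv 0 W = antideriv 1 B ∧
      pderiv 1 W = antideriv 0 B ∧ ∃ q, W = X 0 ^ 2 * X 1 ^ 2 * q ∧
      W.totalDegree ≤ (P 0).totalDegree + 4 := by
    obtain ⟨r, hr⟩ := sq_dvd_antideriv 1 (P 0)
    have e1 : antideriv 1 B = X 1 * (X 1 * (X 0 * r)) := by
      rw [hB, mul_assoc, antideriv_X_mul_of_ne n01, hr]; ring
    obtain ⟨q, hq⟩ := sq_dvd_antideriv 0 r
    refine ⟨antideriv 0 (antideriv 1 B), pderiv_antideriv _ _, ?_, q, ?_, ?_⟩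
    · rw [pderiv_antideriv_of_ne n01.symm, pderiv_antideriv]
    · rw [e1, antideriv_X_mul_of_ne n01.symm, antideriv_X_mul_of_ne n01.symm, hq]; ring
    · have hBd : B.totalDegree ≤ (P 0).totalDegree + 2 := by
        rw [hB]
        refine (totalDegree_mul _ _).trans ?_
        have := totalDegree_mul (X 0 : MvPolynomial (Fin 2) ℝ) (X 1)
        simp only [totalDegree_X] at this
        omega
      have := totalDegree_antideriv_le 0 (antideriv 1 B)
      have := totalDegree_antideriv_le 1 B
      omega
  have d0 : hypotenuse ∣ pderiv 0 W := by
    apply hypotenuse_dvd_of_dvd_pderiv_sub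
    · simp [hq]
    · rw [hW0, dA, pderiv_antideriv, hA]
      exact ⟨X 1 * P 1, by ring⟩
  have d1 : hypotenuse ∣ pderiv 1 W := by
    apply hypotenuse_dvd_of_dvd_pderiv_sub
    · simp [hq, pderiv_X]
    · rw [hW1, dD, pderiv_antideriv, hD]
      exact ⟨-X 0 * P 2, by ring⟩
  have d : hypotenuse ∣ W :=
    hypotenuse_dvd_of_dvd_pderiv_sub (by simp [hq]) (dvd_sub d0 d1)
  obtain ⟨Z, hZ⟩ := hypotenuse_sq_dvd d d0
  obtain ⟨q1, rfl⟩ : hypotenuse ∣ q :=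
    hypotenuse_dvd_of_dvd_sq_mul (hq ▸ d)
  have hc : X 0 ^ 2 * X 1 ^ 2 * q1 = hypotenuse * Z := by
    apply mul_left_cancel₀ hypotenuse_ne_zero
    linear_combination hZ - hq
  obtain ⟨w, rfl⟩ : hypotenuse ∣ q1 :=
    hypotenuse_dvd_of_dvd_sq_mul ⟨Z, hc⟩
  have hWw : w * (hypotenuse * X 0 * X 1) ^ 2 = W := by rw [hq]; ring
  refine ⟨w, ?_, ?_⟩
  · by_cases hw : w = 0
    · exact .inl hw
    right
    have hX (i : Fin 2) : (X i : MvPolynomial (Fin 2) ℝ) ≠ 0 := X_ne_zero i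
    have h3 : hypotenuse * X 0 * X 1 ≠ 0 :=
      mul_ne_zero (mul_ne_zero hypotenuse_ne_zero (hX 0)) (hX 1)
    rw [← hWw, totalDegree_mul_of_isDomain hw (pow_ne_zero 2 h3), sq,
      totalDegree_mul_of_isDomain h3 h3,
      totalDegree_mul_of_isDomain (mul_ne_zero hypotenuse_ne_zero (hX 0)) (hX 1),
      totalDegree_mul_of_isDomain hypotenuse_ne_zero (hX 0), totalDegree_hypotenuse,
      totalDegree_X, totalDegree_X] at hdeg
    omega
  · rw [hWw, hW0, hW1]
    exact ⟨dA, pderiv_antideriv _ _, pderiv_antideriv _ _, dD⟩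

theorem hasFDerivAt_eval_comp {E : Type*} [NormedAddCommGroup E] [NormedSpace ℝ E]
    {f : Fin 2 → E → ℝ} {f' : Fin 2 → E →L[ℝ] ℝ} {x : E} (hf : ∀ i, HasFDerivAt (f i) (f' i) x)
    (Q : MvPolynomial (Fin 2) ℝ) :
    HasFDerivAt (fun y => eval (fun i => f i y) Q)
      (∑ i, eval (fun i => f i x) (pderiv i Q) • f' i) x := by
  induction Q using MvPolynomial.induction_on with
  | C a => simpa using hasFDerivAt_const a x
  | add p q hp hq =>
    simp only [map_add, add_smul, Finset.sum_add_distrib]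
    exact hp.add hq
  | mul_X p i hp =>
    simp only [map_mul, eval_X]
    refine (hp.mul (hf i)).congr_fderiv ?_
    fin_cases i <;> ext v <;> simp [pderiv_X] <;> ring

/-- The affine functions with gradients `a i` and constant terms `c i`. -/
def affineCoord (a : Fin 2 → Fin 2 → ℝ) (c : Fin 2 → ℝ) (y : Fin 2 → ℝ) : Fin 2 → ℝ :=
  fun i => a i 0 * y 0 + a i 1 * y 1 + c i

theorem pd_eval_affineCoord (a : Fin 2 → Fin 2 → ℝ) (c : Fin 2 → ℝ) (j : Fin 2)
    (Q : MvPolynomial (Fin 2) ℝ) :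
    pd j (fun y => eval (affineCoord a c y) Q) =
      fun x => eval (affineCoord a c x) (C (a 0 j) * pderiv 0 Q + C (a 1 j) * pderiv 1 Q) := by
  funext x
  have hf : ∀ i, HasFDerivAt (fun y => affineCoord a c y i)
      (a i 0 • ContinuousLinearMap.proj (R := ℝ) (φ := fun _ : Fin 2 => ℝ) 0 +
        a i 1 • ContinuousLinearMap.proj (R := ℝ) (φ := fun _ : Fin 2 => ℝ) 1) x := fun i =>
    (((hasFDerivAt_apply 0 x).const_mul (a i 0)).add
      ((hasFDerivAt_apply 1 x).const_mul (a i 1))).add_const (c i)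
  have h := (hasFDerivAt_eval_comp hf Q).fderiv
  change fderiv ℝ (fun y => eval (fun i => affineCoord a c y i) Q) x (Pi.single j 1) = _
  rw [h]
  fin_cases j <;> simp <;> ring

theorem totalDegree_aeval_le_of_affine {g : Fin 2 → MvPolynomial (Fin 2) ℝ}
    (hg : ∀ i, (g i).totalDegree ≤ 1) (p : MvPolynomial (Fin 2) ℝ) :
    (aeval g p).totalDegree ≤ p.totalDegree := by
  conv_lhs => rw [p.as_sum, map_sum]
  refine totalDegree_finsetSum_le fun m hm => ?_
  rw [aeval_monomial]
  refine (totalDegree_mul _ _).trans ?_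
  rw [algebraMap_eq, totalDegree_C, zero_add]
  refine (totalDegree_finsetProd _ _).trans (le_trans ?_ (le_totalDegree hm))
  refine Finset.sum_le_sum fun i _ => (totalDegree_pow _ _).trans ?_
  simpa using Nat.mul_le_mul_left (m i) (hg i)

/-- The affine functions `affineCoord a c`, as polynomials. -/
def affinePoly (a : Fin 2 → Fin 2 → ℝ) (c : Fin 2 → ℝ) (i : Fin 2) : MvPolynomial (Fin 2) ℝ :=
  C (a i 0) * X 0 + C (a i 1) * X 1 + C (c i)

theorem totalDegree_affinePoly_le (a : Fin 2 → Fin 2 → ℝ) (c : Fin 2 → ℝ) (i : Fin 2) :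
    (affinePoly a c i).totalDegree ≤ 1 := by
  have h (r : ℝ) (j : Fin 2) : (C r * X j : MvPolynomial (Fin 2) ℝ).totalDegree ≤ 1 :=
    (totalDegree_mul _ _).trans (by simp)
  refine (totalDegree_add _ _).trans (max_le ((totalDegree_add _ _).trans (max_le ?_ ?_)) ?_)
  · exact h _ _
  · exact h _ _
  · simp

theorem eval_aeval_affinePoly (a : Fin 2 → Fin 2 → ℝ) (c x : Fin 2 → ℝ)
    (p : MvPolynomial (Fin 2) ℝ) :
    eval x (aeval (affinePoly a c) p) = eval (affineCoord a c x) p := by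
  rw [← MvPolynomial.coe_aeval_eq_eval, ← MvPolynomial.coe_aeval_eq_eval]
  change ((aeval x).comp (aeval (affinePoly a c))) p = aeval (affineCoord a c x) p
  congr 1
  ext i
  simp [affinePoly, affineCoord]

theorem IsPolyDeg.comp_affineCoord {m : ℤ} {f : (Fin 2 → ℝ) → ℝ} (hf : IsPolyDeg m f)
    (a : Fin 2 → Fin 2 → ℝ) (c : Fin 2 → ℝ) :
    IsPolyDeg m fun x => f (affineCoord a c x) := by
  obtain ⟨p, hp, hd⟩ := hf
  refine ⟨aeval (affinePoly a c) p, fun x => (hp _).trans (eval_aeval_affinePoly a c x p).symm, ?_⟩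
  rcases hd with hd | rfl
  · left
    have := totalDegree_aeval_le_of_affine (totalDegree_affinePoly_le a c) p
    omega
  · exact .inr (map_zero _)

/-- The symmetric tensor `A t₀t₀ᵀ + B (t₀t₁ᵀ + t₁t₀ᵀ) + D t₁t₁ᵀ`, with `tᵢ = perp (a i)`, in the
affine coordinates with gradients `a 0`, `a 1`. -/
def tangentTensor (a : Fin 2 → Fin 2 → ℝ) (A B D : MvPolynomial (Fin 2) ℝ) (i j : Fin 2) :
    MvPolynomial (Fin 2) ℝ :=
  C (perp (a 0) i * perp (a 0) j) * A +
    C (perp (a 0) i * perp (a 1) j + perp (a 1) i * perp (a 0) j) * B +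
    C (perp (a 1) i * perp (a 1) j) * D

theorem pderiv_tangentTensor (a : Fin 2 → Fin 2 → ℝ) (A B D : MvPolynomial (Fin 2) ℝ)
    (i j l : Fin 2) : pderiv l (tangentTensor a A B D i j) =
      tangentTensor a (pderiv l A) (pderiv l B) (pderiv l D) i j := by
  rw [tangentTensor, map_add, map_add, pderiv_C_mul, pderiv_C_mul, pderiv_C_mul, tangentTensor]

theorem pderiv_eq_of_div_tangentTensor_eq_zero {a : Fin 2 → Fin 2 → ℝ} {c : Fin 2 → ℝ}
    (ha : a 0 0 * a 1 1 - a 0 1 * a 1 0 ≠ 0) (hsurj : Function.Surjective (affineCoord a c))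
    {A B D : MvPolynomial (Fin 2) ℝ}
    (h : ∀ x i, pd 0 (fun y => eval (affineCoord a c y) (tangentTensor a A B D i 0)) x +
      pd 1 (fun y => eval (affineCoord a c y) (tangentTensor a A B D i 1)) x = 0) :
    pderiv 1 A = pderiv 0 B ∧ pderiv 1 B = pderiv 0 D := by
  have key : ∀ z, eval z (pderiv 1 A) = eval z (pderiv 0 B) ∧
      eval z (pderiv 1 B) = eval z (pderiv 0 D) := by
    intro z
    obtain ⟨x, rfl⟩ := hsurj z
    have h0 := h x 0
    have h1 := h x 1
    simp only [pd_eval_affineCoord, pderiv_tangentTensor] at h0 h1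
    simp only [tangentTensor, perp, map_add, map_mul, eval_C,
      Matrix.cons_val_zero, Matrix.cons_val_one] at h0 h1
    constructor <;> apply mul_left_cancel₀ (mul_ne_zero ha ha)
    · linear_combination a 1 0 * h0 + a 1 1 * h1
    · linear_combination -a 0 0 * h0 - a 0 1 * h1
  exact ⟨MvPolynomial.funext fun z => (key z).1, MvPolynomial.funext fun z => (key z).2⟩

/-- The barycentric coordinates `lam 1`, `lam 2` of a triangle form an invertible affine change of
coordinates whose gradients are given by `nvec`. -/
theorem exists_lam_eq_affineCoord {x0 x1 x2 : Fin 2 → ℝ} {lam : Fin 3 → (Fin 2 → ℝ) → ℝ}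
    (hlam_aff : ∀ i, IsAffineFn (lam i))
    (hlam_val : ∀ i j : Fin 3, lam i (![x0, x1, x2] j) = if i = j then 1 else 0) :
    ∃ (a b : Fin 2 → Fin 2 → ℝ) (c : Fin 2 → ℝ), a 0 0 * a 1 1 - a 0 1 * a 1 0 ≠ 0 ∧
      nvec x0 x1 x2 1 = a 0 ∧ nvec x0 x1 x2 2 = a 1 ∧ nvec x0 x1 x2 0 = -a 0 - a 1 ∧
      (∀ x, lam 1 x = affineCoord a c x 0) ∧ (∀ x, lam 2 x = affineCoord a c x 1) ∧
      (∀ x, lam 0 x = 1 - lam 1 x - lam 2 x) ∧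
      (∀ x, affineCoord b x0 (affineCoord a c x) = x) ∧
      (∀ z, affineCoord a c (affineCoord b x0 z) = z) := by
  choose a c ha using hlam_aff
  have h (i : Fin 3) : lam i x0 = (if i = 0 then 1 else 0) ∧ lam i x1 = (if i = 1 then 1 else 0) ∧
      lam i x2 = if i = 2 then 1 else 0 := ⟨hlam_val i 0, hlam_val i 1, hlam_val i 2⟩
  obtain ⟨h00, h01, h02⟩ := h 0
  obtain ⟨h10, h11, h12⟩ := h 1
  obtain ⟨h20, h21, h22⟩ := h 2
  simp [ha] at h00 h01 h02 h10 h11 h12 h20 h21 h22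
  have hNB : Matrix.of ![a 1, a 2] * Bmat x0 x1 x2 = 1 := by
    ext i j
    fin_cases i <;> fin_cases j <;> simp [Matrix.mul_apply, Bmat] <;> linarith
  have hinv : (Bmat x0 x1 x2)⁻¹ = Matrix.of ![a 1, a 2] := Matrix.inv_eq_left_inv hNB
  have hBN := mul_eq_one_comm.mp hNB
  have hdet := congrArg Matrix.det hNB
  rw [Matrix.det_mul, Matrix.det_one, Matrix.det_fin_two] at hdet
  have e00 := congrFun (congrFun hBN 0) 0
  have e01 := congrFun (congrFun hBN 0) 1
  have e10 := congrFun (congrFun hBN 1) 0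
  have e11 := congrFun (congrFun hBN 1) 1
  simp [Matrix.mul_apply, Bmat] at e00 e01 e10 e11
  have hx (x : Fin 2 → ℝ) : ∀ i,
      x i = (x1 i - x0 i) * lam 1 x + (x2 i - x0 i) * lam 2 x + x0 i := by
    rw [ha, ha]
    refine Fin.forall_fin_two.2 ⟨?_, ?_⟩
    · linear_combination (x0 0 - x 0) * e00 + (x0 1 - x 1) * e01 - (x1 0 - x0 0) * h10
        - (x2 0 - x0 0) * h20
    · linear_combination (x0 0 - x 0) * e10 + (x0 1 - x 1) * e11 - (x1 1 - x0 1) * h10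
        - (x2 1 - x0 1) * h20
  refine ⟨![a 1, a 2], fun i => ![x1 i - x0 i, x2 i - x0 i], ![c 1, c 2], fun h0 => ?_, ?_, ?_,
    ?_, fun x => ?_, fun x => ?_,
    fun x => ?_, fun x => ?_, fun z => ?_⟩
  · simp at h0 hdet
    simp [h0] at hdet
  · simp [nvec, hinv]
  · simp [nvec, hinv]
  · ext j
    simp [nvec, hinv]
  · simp [affineCoord, ha]
  · simp [affineCoord, ha]
  · rw [ha 0 x]
    linear_combination a 0 0 * hx x 0 + a 0 1 * hx x 1 + (1 - lam 1 x - lam 2 x) * h00 +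
      lam 1 x * h01 + lam 2 x * h02
  · ext i
    rw [hx x i, ha, ha]
    simp [affineCoord]
  · ext i
    fin_cases i <;> simp [affineCoord]
    · linear_combination z 0 * (h11 - h10) + z 1 * (h12 - h10) + h10
    · linear_combination z 0 * (h21 - h20) + z 1 * (h22 - h20) + h20

theorem stmt_12 (k : ℕ) (hk : 3 ≤ k)
    (x0 x1 x2 : Fin 2 → ℝ)
    (hind : AffineIndependent ℝ ![x0, x1, x2])
    (lam : Fin 3 → (Fin 2 → ℝ) → ℝ)
    (hlam_aff : ∀ i, IsAffineFn (lam i))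
    (hlam_val : ∀ i j : Fin 3, lam i (![x0, x1, x2] j) = if i = j then 1 else 0)
    (τ : (Fin 2 → ℝ) → Matrix (Fin 2) (Fin 2) ℝ)
    (hτ : SigmaKb k x0 x1 x2 lam τ)
    (hdiv : ∀ x, matDiv τ x = 0) :
    ∃ w : (Fin 2 → ℝ) → ℝ, IsPolyDeg ((k : ℤ) - 4) w ∧
      (∀ x, τ x 0 0 =
        pd 1 (pd 1 (fun y => w y * (lam 0 y * lam 1 y * lam 2 y) ^ 2)) x) ∧
      (∀ x, τ x 0 1 =
        -(pd 0 (pd 1 (fun y => w y * (lam 0 y * lam 1 y * lam 2 y) ^ 2)) x)) ∧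
      (∀ x, τ x 1 0 =
        -(pd 0 (pd 1 (fun y => w y * (lam 0 y * lam 1 y * lam 2 y) ^ 2)) x)) ∧
      (∀ x, τ x 1 1 =
        pd 0 (pd 0 (fun y => w y * (lam 0 y * lam 1 y * lam 2 y) ^ 2)) x) := by
  obtain ⟨p, hp, rfl⟩ := hτ
  obtain ⟨a, b, c, hdet, hn1, hn2, hn0, hl1, hl2, hl0, hleft, hright⟩ :=
    exists_lam_eq_affineCoord hlam_aff hlam_val
  choose P hP hPdeg using fun i => (hp i).comp_affineCoord b x0
  have hpP (i : Fin 3) (x : Fin 2 → ℝ) : p i x = eval (affineCoord a c x) (P i) := by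
    simp only [← hP, hleft]
  have hl1' (x) : lam 1 x = eval (affineCoord a c x) (X 0) := by rw [eval_X, hl1]
  have hl2' (x) : lam 2 x = eval (affineCoord a c x) (X 1) := by rw [eval_X, hl2]
  have hl0' (x) : lam 0 x = eval (affineCoord a c x) hypotenuse := by
    simp only [hl0, hl1', hl2', hypotenuse, map_sub, map_one]
  obtain ⟨B, hB⟩ : ∃ B, B = X 0 * X 1 * P 0 := ⟨_, rfl⟩
  obtain ⟨A, hA⟩ : ∃ A, A = X 1 * hypotenuse * P 1 + B := ⟨_, rfl⟩
  obtain ⟨D, hD⟩ : ∃ D, D = hypotenuse * X 0 * P 2 + B := ⟨_, rfl⟩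
  have hτ (x : Fin 2 → ℝ) (i j : Fin 2) : bubbleStress x0 x1 x2 lam p x i j =
      eval (affineCoord a c x) (tangentTensor a A B D i j) := by
    simp only [bubbleStress, hn0, hn1, hn2, vvT, tangentTensor, hl0', hl1', hl2', hpP, hA, hB, hD,
      Matrix.add_apply, Matrix.smul_apply, Matrix.of_apply, smul_eq_mul, map_add, map_mul, eval_C]
    fin_cases i <;> fin_cases j <;> simp [perp] <;> ring
  obtain ⟨hAB, hBD⟩ := pderiv_eq_of_div_tangentTensor_eq_zero hdet
    (fun z => ⟨_, hright z⟩) (A := A) (B := B) (D := D) fun x i => by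
      simpa only [matDiv, hτ, Pi.zero_apply] using congrFun (hdiv x) i
  obtain ⟨w, hw, hwA, hwB, hwB', hwD⟩ := exists_airy_potential hA hB hD hAB hBD
  have hWfun : (fun y => eval (affineCoord a c y) w * (lam 0 y * lam 1 y * lam 2 y) ^ 2) =
      fun y => eval (affineCoord a c y) (w * (hypotenuse * X 0 * X 1) ^ 2) := by
    funext y
    simp only [hl0', hl1', hl2', map_mul, map_pow]
  refine ⟨fun y => eval (affineCoord a c y) w, IsPolyDeg.comp_affineCoord
    ⟨w, fun _ => rfl, ?_⟩ a c, ?_⟩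
  · rcases hw with rfl | hw
    · exact .inr rfl
    · left
      rcases hPdeg 0 with h | h
      · omega
      · rw [h, totalDegree_zero] at hw
        omega
  · rw [hWfun]
    simp only [hτ, pd_eval_affineCoord]
    simp only [map_add, pderiv_C_mul, hwA, hwB, hwB', hwD, tangentTensor,
      map_mul, eval_C, perp, Matrix.cons_val_zero, Matrix.cons_val_one]
    refine ⟨fun x => ?_, fun x => ?_, fun x => ?_, fun x => ?_⟩ <;> ring
end
end

section
/- Let k ≥ 3 be an integer. Then the vector space {div τ : τ ∈ Σ_{K,b}} has dimension k² + k − 3. -/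
open MeasureTheory

noncomputable section

namespace BubbleDiv

open MvPolynomial

local notation "MP" => MvPolynomial (Fin 2) ℝ

/-! ### Bivariate monomials -/

/-- The monomial `u ^ a * v ^ b` in two variables. -/
def mon (a b : ℕ) : MP := X 0 ^ a * X 1 ^ b

lemma monomial_one_eq_mon (s : Fin 2 →₀ ℕ) : (monomial s (1 : ℝ) : MP) = mon (s 0) (s 1) := by
  rw [monomial_eq, Finsupp.prod_fintype _ _ (by simp)]
  simp [mon, Fin.prod_univ_two]

/-- The exponent of `u ^ a * v ^ b`. -/
def expo (a b : ℕ) : Fin 2 →₀ ℕ := Finsupp.equivFunOnFinite.symm ![a, b]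

@[simp] lemma expo_zero (a b : ℕ) : expo a b 0 = a := rfl

@[simp] lemma expo_one (a b : ℕ) : expo a b 1 = b := rfl

lemma mon_eq_monomial (a b : ℕ) : mon a b = monomial (expo a b) 1 := by
  simp [monomial_one_eq_mon]

lemma mem_degree_le {n : ℕ} {s : Fin 2 →₀ ℕ} :
    s ∈ {s : Fin 2 →₀ ℕ | (s.sum fun _ e => e) ≤ n} ↔ s 0 + s 1 ≤ n := by
  rw [Set.mem_ofPred_eq, Finsupp.sum_fintype _ _ (by simp), Fin.sum_univ_two]

lemma restrictTotalDegree_eq_span (n : ℕ) :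
    restrictTotalDegree (Fin 2) ℝ n = Submodule.span ℝ {p | ∃ a b, a + b ≤ n ∧ mon a b = p} := by
  rw [restrictTotalDegree, restrictSupport_eq_span]
  congr 1
  ext p
  constructor
  · rintro ⟨s, hs, rfl⟩
    exact ⟨s 0, s 1, mem_degree_le.1 hs, (monomial_one_eq_mon s).symm⟩
  · rintro ⟨a, b, hab, rfl⟩
    exact ⟨expo a b, mem_degree_le.2 hab, (mon_eq_monomial a b).symm⟩

lemma mon_mem {a b n : ℕ} (h : a + b ≤ n) : mon a b ∈ restrictTotalDegree (Fin 2) ℝ n := by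
  rw [restrictTotalDegree_eq_span]
  exact Submodule.subset_span ⟨a, b, h, rfl⟩

lemma two_mul_finrank_restrictTotalDegree (n : ℕ) :
    2 * Module.finrank ℝ (restrictTotalDegree (Fin 2) ℝ n) = (n + 1) * (n + 2) := by
  have e : {s : Fin 2 →₀ ℕ | (s.sum fun _ e => e) ≤ n} ≃
      (Finset.range (n + 1)).sigma fun i => Finset.range (i + 1) :=
    { toFun := fun s => ⟨⟨s.1 0 + s.1 1, s.1 0⟩, by
        have := mem_degree_le.1 s.2
        simp only [Finset.mem_sigma, Finset.mem_range]
        omega⟩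
      invFun := fun t => ⟨expo t.1.2 (t.1.1 - t.1.2), by
        have := t.2
        simp only [Finset.mem_sigma, Finset.mem_range] at this
        rw [mem_degree_le, expo_zero, expo_one]
        omega⟩
      left_inv := by
        rintro ⟨s, hs⟩
        ext i
        fin_cases i <;> simp
      right_inv := by
        rintro ⟨⟨i, a⟩, ht⟩
        simp only [Finset.mem_sigma, Finset.mem_range] at ht
        have : a + (i - a) = i := by omega
        simp [this] }
  have hrank : Module.finrank ℝ (restrictTotalDegree (Fin 2) ℝ n) =
      Nat.card {s : Fin 2 →₀ ℕ | (s.sum fun _ e => e) ≤ n} :=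
    Module.finrank_eq_nat_card_basis (basisRestrictSupport ℝ _)
  rw [hrank, Nat.card_congr e, Nat.card_eq_fintype_card, Fintype.card_coe, Finset.card_sigma]
  simp only [Finset.card_range]
  clear hrank e
  induction n with
  | zero => rfl
  | succ n ih => rw [Finset.sum_range_succ, mul_add, ih]; ring

lemma linearMap_ext_mon {M : Type*} [AddCommGroup M] [Module ℝ M] {f g : MP →ₗ[ℝ] M}
    (h : ∀ a b, f (mon a b) = g (mon a b)) : f = g := by
  refine (basisMonomials (Fin 2) ℝ).ext fun s => ?_
  simpa [monomial_one_eq_mon] using h (s 0) (s 1)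

lemma pderiv_zero_mon (a b : ℕ) : pderiv 0 (mon a b) = (a : ℝ) • mon (a - 1) b := by
  simp only [mon, Derivation.leibniz, Derivation.leibniz_pow, pderiv_X_self,
    pderiv_X_of_ne (show (1 : Fin 2) ≠ 0 by decide), smul_eq_mul, MvPolynomial.smul_eq_C_mul,
    nsmul_eq_mul, map_natCast]
  ring

lemma pderiv_one_mon (a b : ℕ) : pderiv 1 (mon a b) = (b : ℝ) • mon a (b - 1) := by
  simp only [mon, Derivation.leibniz, Derivation.leibniz_pow, pderiv_X_self,
    pderiv_X_of_ne (show (0 : Fin 2) ≠ 1 by decide), smul_eq_mul, MvPolynomial.smul_eq_C_mul,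
    nsmul_eq_mul, map_natCast]
  ring

/-! ### Integration over the reference triangle -/

/-- Integration over the triangle with vertices `(0,0)`, `(1,0)`, `(0,1)`, given on monomials by
`∫ u ^ a * v ^ b = a! b! / (a + b + 2)!`. -/
def refIntegral : MP →ₗ[ℝ] ℝ :=
  (basisMonomials (Fin 2) ℝ).constr ℝ fun s =>
    ((s 0).factorial * (s 1).factorial : ℝ) / (s 0 + s 1 + 2).factorial

lemma refIntegral_mon (a b : ℕ) :
    refIntegral (mon a b) = (a.factorial * b.factorial : ℝ) / (a + b + 2).factorial := by
  have := (basisMonomials (Fin 2) ℝ).constr_basis ℝ (fun s : Fin 2 →₀ ℕ =>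
    ((s 0).factorial * (s 1).factorial : ℝ) / (s 0 + s 1 + 2).factorial) (expo a b)
  simpa [mon_eq_monomial, refIntegral] using this

lemma bubble_one_mon (a b : ℕ) : X 1 * (1 - X 0 - X 1) * mon a b =
    mon a (b + 1) - mon (a + 1) (b + 1) - mon a (b + 2) := by
  simp only [mon]; ring

lemma bubble_two_mon (a b : ℕ) : X 0 * (1 - X 0 - X 1) * mon a b =
    mon (a + 1) b - mon (a + 2) b - mon (a + 1) (b + 1) := by
  simp only [mon]; ring

lemma bubble_zero_mon (a b : ℕ) : X 0 * X 1 * mon a b = mon (a + 1) (b + 1) := by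
  simp only [mon]; ring

lemma refIntegral_pderiv_one (p : MP) :
    refIntegral (pderiv 1 (X 1 * (1 - X 0 - X 1) * p)) = 0 := by
  have : refIntegral ∘ₗ ((pderiv 1 : Derivation ℝ MP MP) : MP →ₗ[ℝ] MP) ∘ₗ
      LinearMap.mulLeft ℝ (X 1 * (1 - X 0 - X 1)) = 0 := by
    refine linearMap_ext_mon fun a b => ?_
    simp only [LinearMap.comp_apply, LinearMap.mulLeft_apply, bubble_one_mon, map_sub,
      Derivation.coeFn_coe, pderiv_one_mon, map_smul,
      refIntegral_mon, LinearMap.zero_apply, smul_eq_mul, Nat.add_sub_cancel,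
      show b + 2 - 1 = b + 1 from rfl, show a + 1 + b + 2 = a + b + 2 + 1 by ring,
      show a + (b + 1) + 2 = a + b + 2 + 1 by ring, Nat.factorial_succ]
    have := Nat.factorial_ne_zero (a + b)
    push_cast
    field_simp
    ring
  exact LinearMap.congr_fun this p

lemma refIntegral_pderiv_zero (p : MP) :
    refIntegral (pderiv 0 (X 0 * (1 - X 0 - X 1) * p)) = 0 := by
  have : refIntegral ∘ₗ ((pderiv 0 : Derivation ℝ MP MP) : MP →ₗ[ℝ] MP) ∘ₗ
      LinearMap.mulLeft ℝ (X 0 * (1 - X 0 - X 1)) = 0 := by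
    refine linearMap_ext_mon fun a b => ?_
    simp only [LinearMap.comp_apply, LinearMap.mulLeft_apply, bubble_two_mon, map_sub,
      Derivation.coeFn_coe, pderiv_zero_mon, map_smul,
      refIntegral_mon, LinearMap.zero_apply, smul_eq_mul, Nat.add_sub_cancel,
      show a + 2 - 1 = a + 1 from rfl, show a + 1 + b + 2 = a + b + 2 + 1 by ring,
      show a + (b + 1) + 2 = a + b + 2 + 1 by ring, Nat.factorial_succ]
    have := Nat.factorial_ne_zero (a + b)
    push_cast
    field_simp
    ring
  exact LinearMap.congr_fun this p

lemma refIntegral_pderiv_sub (p : MP) :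
    refIntegral (pderiv 1 (X 0 * X 1 * p) - pderiv 0 (X 0 * X 1 * p)) = 0 := by
  have : refIntegral ∘ₗ (((pderiv 1 : Derivation ℝ MP MP) : MP →ₗ[ℝ] MP) -
      ((pderiv 0 : Derivation ℝ MP MP) : MP →ₗ[ℝ] MP)) ∘ₗ LinearMap.mulLeft ℝ (X 0 * X 1) = 0 := by
    refine linearMap_ext_mon fun a b => ?_
    simp only [LinearMap.comp_apply, LinearMap.mulLeft_apply, bubble_zero_mon, map_sub,
      LinearMap.sub_apply,
      Derivation.coeFn_coe, pderiv_zero_mon, pderiv_one_mon, map_smul,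
      refIntegral_mon, LinearMap.zero_apply, smul_eq_mul, Nat.add_sub_cancel,
      show a + 1 + b + 2 = a + b + 2 + 1 by ring,
      show a + (b + 1) + 2 = a + b + 2 + 1 by ring, Nat.factorial_succ]
    push_cast
    ring
  exact LinearMap.congr_fun this p

/-! ### The divergence in reference coordinates -/

/-- The divergence of a bubble stress in barycentric coordinates `(u, v) = (λ₁, λ₂)`, expressed in
a basis of tangent directions. -/
def refDiv : (Fin 3 → MP) →ₗ[ℝ] MP × MP where
  toFun p :=
    (pderiv 1 (X 1 * (1 - X 0 - X 1) * p 1) +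
      (pderiv 1 (X 0 * X 1 * p 0) - pderiv 0 (X 0 * X 1 * p 0)),
    pderiv 0 (X 0 * (1 - X 0 - X 1) * p 2) -
      (pderiv 1 (X 0 * X 1 * p 0) - pderiv 0 (X 0 * X 1 * p 0)))
  map_add' p q := by
    simp only [Pi.add_apply, mul_add, map_add, Prod.mk_add_mk]
    ext1 <;> dsimp only <;> ring
  map_smul' c p := by
    simp only [Pi.smul_apply, mul_smul_comm, Derivation.map_smul, RingHom.id_apply, Prod.smul_mk,
      smul_add, smul_sub]

/-- Triples of polynomials of total degree at most `n`. -/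
def coeffSpace (n : ℕ) : Submodule ℝ (Fin 3 → MP) :=
  Submodule.pi Set.univ fun _ => restrictTotalDegree (Fin 2) ℝ n

/-- Pairs of polynomials of total degree at most `n`. -/
def vecSpace (n : ℕ) : Submodule ℝ (MP × MP) :=
  (restrictTotalDegree (Fin 2) ℝ n).prod (restrictTotalDegree (Fin 2) ℝ n)

lemma vecSpace_eq_range (n : ℕ) : vecSpace n = LinearMap.range
    ((restrictTotalDegree (Fin 2) ℝ n).subtype.prodMap
      (restrictTotalDegree (Fin 2) ℝ n).subtype) := by
  rw [LinearMap.range_prodMap, Submodule.range_subtype, vecSpace]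

instance (n : ℕ) : FiniteDimensional ℝ (vecSpace n) := by
  rw [vecSpace_eq_range]; infer_instance

lemma finrank_vecSpace (n : ℕ) : Module.finrank ℝ (vecSpace n) = (n + 1) * (n + 2) := by
  rw [← two_mul_finrank_restrictTotalDegree, two_mul, vecSpace_eq_range,
    LinearMap.finrank_range_of_inj, Module.finrank_prod]
  exact Function.Injective.prodMap (Submodule.subtype_injective _)
    (Submodule.subtype_injective _)

lemma mem_coeffSpace {n : ℕ} {p : Fin 3 → MP} :
    p ∈ coeffSpace n ↔ ∀ i, p i ∈ restrictTotalDegree (Fin 2) ℝ n := by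
  simp [coeffSpace, Submodule.mem_pi]

lemma coeffSpace_mono {m n : ℕ} (h : m ≤ n) : coeffSpace m ≤ coeffSpace n := by
  intro p hp
  rw [mem_coeffSpace] at *
  intro i
  have := hp i
  rw [mem_restrictTotalDegree] at *
  omega

lemma pderiv_mul_mem {n : ℕ} (i : Fin 2) {q p : MP} (hq : q.totalDegree ≤ 2)
    (hp : p ∈ restrictTotalDegree (Fin 2) ℝ n) :
    pderiv i (q * p) ∈ restrictTotalDegree (Fin 2) ℝ (n + 1) := by
  have hqp : q * p ∈ restrictTotalDegree (Fin 2) ℝ (n + 2) := by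
    rw [mem_restrictTotalDegree] at *
    have := totalDegree_mul q p
    omega
  generalize q * p = r at hqp
  rw [restrictTotalDegree_eq_span] at hqp
  induction hqp using Submodule.span_induction with
  | mem x hx =>
    obtain ⟨a, b, hab, rfl⟩ := hx
    fin_cases i
    · rw [show (⟨0, _⟩ : Fin 2) = 0 from rfl, pderiv_zero_mon]
      rcases a with _ | a
      · simp
      · exact Submodule.smul_mem _ _ (mon_mem (by omega))
    · rw [show (⟨1, _⟩ : Fin 2) = 1 from rfl, pderiv_one_mon]
      rcases b with _ | b
      · simp
      · exact Submodule.smul_mem _ _ (mon_mem (by omega))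
  | zero => simp
  | add x y _ _ hx hy => rw [map_add]; exact Submodule.add_mem _ hx hy
  | smul c x _ hx => rw [Derivation.map_smul]; exact Submodule.smul_mem _ _ hx

lemma map_refDiv_le (n : ℕ) : (coeffSpace n).map refDiv ≤ vecSpace (n + 1) := by
  have h0 : ((X 0 * X 1 : MP)).totalDegree ≤ 2 := by
    simpa [mon] using (mem_restrictTotalDegree _ _ _).1 (mon_mem (a := 1) (b := 1) (n := 2) le_rfl)
  have hone (q : MP) : q = q * mon 0 0 := by simp [mon]
  have h1 : ((X 1 * (1 - X 0 - X 1) : MP)).totalDegree ≤ 2 := by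
    rw [← mem_restrictTotalDegree, hone (X 1 * (1 - X 0 - X 1)), bubble_one_mon]
    exact Submodule.sub_mem _ (Submodule.sub_mem _ (mon_mem (by simp)) (mon_mem (by simp)))
      (mon_mem (by simp))
  have h2 : ((X 0 * (1 - X 0 - X 1) : MP)).totalDegree ≤ 2 := by
    rw [← mem_restrictTotalDegree, hone (X 0 * (1 - X 0 - X 1)), bubble_two_mon]
    exact Submodule.sub_mem _ (Submodule.sub_mem _ (mon_mem (by simp)) (mon_mem (by simp)))
      (mon_mem (by simp))
  rintro _ ⟨p, hp, rfl⟩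
  have hp := mem_coeffSpace.1 hp
  have hd := Submodule.sub_mem _ (pderiv_mul_mem 1 h0 (hp 0)) (pderiv_mul_mem 0 h0 (hp 0))
  exact ⟨Submodule.add_mem _ (pderiv_mul_mem 1 h1 (hp 1)) hd,
    Submodule.sub_mem _ (pderiv_mul_mem 0 h2 (hp 2)) hd⟩

/-- The span of `(1, 0)`, `(u, 0)`, `(0, 1)`, which complements the range of `refDiv`. -/
def complMap : (Fin 3 → ℝ) →ₗ[ℝ] MP × MP where
  toFun c := (c 0 • mon 0 0 + c 1 • mon 1 0, c 2 • mon 0 0)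
  map_add' c d := by ext1 <;> simp only [Pi.add_apply, Prod.mk_add_mk] <;> module
  map_smul' r c := by
    ext1 <;> simp only [Pi.smul_apply, smul_eq_mul, Prod.smul_mk, RingHom.id_apply] <;> module

lemma complMap_eq_zero {c : Fin 3 → ℝ} {p : Fin 3 → MP} (h : refDiv p = complMap c) : c = 0 := by
  have h1 := congrArg Prod.fst h
  have h2 := congrArg Prod.snd h
  simp only [refDiv, complMap, LinearMap.coe_mk, AddHom.coe_mk] at h1 h2
  have i1 := congrArg refIntegral h1
  have i2 := congrArg refIntegral h2
  have i3 : refIntegral (X 0 * (c 0 • mon 0 0 + c 1 • mon 1 0) - X 1 * (c 2 • mon 0 0)) = 0 := by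
    rw [← h1, ← h2]
    have j1 := refIntegral_pderiv_one (X 0 * p 1)
    have j2 := refIntegral_pderiv_zero (X 1 * p 2)
    have j3 := refIntegral_pderiv_sub ((X 0 + X 1) * p 0)
    rw [mul_left_comm, Derivation.leibniz, pderiv_X_of_ne (by decide)] at j1 j2
    rw [mul_left_comm, Derivation.leibniz _ (X 0 + X 1) (X 0 * X 1 * p 0),
      Derivation.leibniz _ (X 0 + X 1) (X 0 * X 1 * p 0), map_add, map_add, pderiv_X_self,
      pderiv_X_self, pderiv_X_of_ne (by decide), pderiv_X_of_ne (by decide)] at j3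
    simp only [smul_eq_mul, mul_zero, add_zero, zero_add, mul_one] at j1 j2 j3
    have := congrArg₂ (· + ·) (congrArg₂ (· - ·) j1 j2) j3
    simp only [← map_sub, ← map_add, sub_zero, add_zero] at this
    rw [← this]
    congr 1
    ring
  rw [map_add, refIntegral_pderiv_one, refIntegral_pderiv_sub] at i1
  rw [map_sub, refIntegral_pderiv_zero, refIntegral_pderiv_sub] at i2
  rw [show X 0 * (c 0 • mon 0 0 + c 1 • mon 1 0) - X 1 * (c 2 • mon 0 0) =
    c 0 • mon 1 0 + c 1 • mon 2 0 - c 2 • mon 0 1 by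
      simp only [mon, MvPolynomial.smul_eq_C_mul]; ring] at i3
  simp only [map_add, map_sub, map_smul, refIntegral_mon, smul_eq_mul] at i1 i2 i3
  norm_num [Nat.factorial] at i1 i2 i3
  ext i
  fin_cases i <;> simp <;> linarith

lemma complMap_injective : Function.Injective complMap := by
  refine (injective_iff_map_eq_zero complMap).2 fun c hc => complMap_eq_zero (p := 0) ?_
  rw [hc, map_zero]

/-- The top degree part of the surjectivity of `refDiv`: the classes `e a b`, `f a b` of
`(u ^ a * v ^ b, 0)` and `(0, u ^ a * v ^ b)` of degree `n + 1` modulo divergences and lower degree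
vanish. -/
lemma top_degree_vanish {V : Type*} [AddCommGroup V] [Module ℝ V] (e f : ℕ → ℕ → V) {n : ℕ}
    (hn : 1 ≤ n)
    (h1 : ∀ a b, a + b = n → ((b : ℝ) + 1) • e (a + 1) b + ((b : ℝ) + 2) • e a (b + 1) = 0)
    (h2 : ∀ a b, a + b = n → ((a : ℝ) + 1) • f a (b + 1) + ((a : ℝ) + 2) • f (a + 1) b = 0)
    (h0 : ∀ a b, a + b = n → ((b : ℝ) + 1) • (e (a + 1) b - f (a + 1) b) -
      ((a : ℝ) + 1) • (e a (b + 1) - f a (b + 1)) = 0)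
    {a b : ℕ} (hab : a + b = n + 1) : e a b = 0 ∧ f a b = 0 := by
  have he : ∀ b a, a + b = n + 1 → ((b : ℝ) + 1) • e a b = (-1 : ℝ) ^ b • e (n + 1) 0 := by
    intro b
    induction b with
    | zero => rintro a rfl; simp
    | succ b ih =>
      intro a hab
      have r := h1 a b (by omega)
      have i := ih (a + 1) (by omega)
      push_cast
      rw [pow_succ]
      linear_combination (norm := module) r - i
  have hf : ∀ a b, a + b = n + 1 → ((a : ℝ) + 1) • f a b = (-1 : ℝ) ^ a • f 0 (n + 1) := by
    intro a
    induction a with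
    | zero =>
      intro b hb
      obtain rfl : b = n + 1 := by omega
      simp
    | succ a ih =>
      intro b hab
      have r := h2 a b (by omega)
      have i := ih (b + 1) (by omega)
      push_cast
      rw [pow_succ]
      linear_combination (norm := module) r - i
  have hs : ((-1 : ℝ) ^ n) * (-1) ^ n = 1 := by rw [← mul_pow]; simp
  have hn0 : (1 : ℝ) ≤ n := by exact_mod_cast hn
  have r1 := h0 n 0 (by omega)
  have r2 := h0 0 n (by omega)
  have e1 := he 1 n rfl
  have e2 := he n 1 (by omega)
  have e3 := he (n + 1) 0 (by omega)
  have f1 := hf 1 n (by omega)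
  have f2 := hf n 1 (by omega)
  have f3 := hf (n + 1) 0 (by omega)
  push_cast [pow_succ] at *
  generalize (-1 : ℝ) ^ n = s at *
  have k1 : (((n : ℝ) + 3) * (n + 2)) • e (n + 1) 0 + (2 * ((n : ℝ) + 3) * s) • f 0 (n + 1) = 0 := by
    linear_combination (norm := module) (2 * ((n : ℝ) + 2)) • r1 + (2 : ℝ) • f3 +
      (((n : ℝ) + 1) * (n + 2)) • e1 - (2 * ((n : ℝ) + 2)) • f2
  have k2 : (2 * ((n : ℝ) + 3) * s) • e (n + 1) 0 + (((n : ℝ) + 3) * (n + 2)) • f 0 (n + 1) = 0 := by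
    linear_combination (norm := module) (2 * ((n : ℝ) + 2)) • r2 + (2 : ℝ) • e3 +
      (((n : ℝ) + 1) * (n + 2)) • f1 - (2 * ((n : ℝ) + 2)) • e2
  have hc : ((n : ℝ) + 3) * ((n + 2) ^ 2 - 4) ≠ 0 :=
    mul_ne_zero (by positivity) (by nlinarith)
  have hE : e (n + 1) 0 = 0 := by
    refine (smul_eq_zero.1 (?_ : (((n : ℝ) + 3) * ((n + 2) ^ 2 - 4)) • e (n + 1) 0 = 0)).resolve_left hc
    rw [show ((n : ℝ) + 3) * ((n + 2) ^ 2 - 4) = (n + 3) * ((n + 2) ^ 2 - 4 * (s * s)) by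
      rw [hs, mul_one]]
    linear_combination (norm := module) ((n : ℝ) + 2) • k1 - (2 * s) • k2
  have hF : f 0 (n + 1) = 0 := by
    refine (smul_eq_zero.1 (?_ : (((n : ℝ) + 3) * ((n + 2) ^ 2 - 4)) • f 0 (n + 1) = 0)).resolve_left hc
    rw [show ((n : ℝ) + 3) * ((n + 2) ^ 2 - 4) = (n + 3) * ((n + 2) ^ 2 - 4 * (s * s)) by
      rw [hs, mul_one]]
    linear_combination (norm := module) ((n : ℝ) + 2) • k2 - (2 * s) • k1
  constructor
  · have := he b a hab
    rw [hE, smul_zero] at this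
    exact (smul_eq_zero.1 this).resolve_left (by positivity)
  · have := hf a b hab
    rw [hF, smul_zero] at this
    exact (smul_eq_zero.1 this).resolve_left (by positivity)

lemma refDiv_one_mon (a b : ℕ) : refDiv ![0, mon a b, 0] =
    (((b : ℝ) + 1) • mon a b - ((b : ℝ) + 1) • mon (a + 1) b - ((b : ℝ) + 2) • mon a (b + 1), 0) := by
  simp only [refDiv, LinearMap.coe_mk, AddHom.coe_mk, Matrix.cons_val, bubble_one_mon, mul_zero,
    map_zero, map_sub, pderiv_one_mon, Nat.add_sub_cancel, add_zero, sub_zero,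
    show b + 2 - 1 = b + 1 from rfl]
  push_cast
  rfl

lemma refDiv_two_mon (a b : ℕ) : refDiv ![0, 0, mon a b] =
    (0, ((a : ℝ) + 1) • mon a b - ((a : ℝ) + 2) • mon (a + 1) b - ((a : ℝ) + 1) • mon a (b + 1)) := by
  simp only [refDiv, LinearMap.coe_mk, AddHom.coe_mk, Matrix.cons_val, bubble_two_mon, mul_zero,
    map_zero, map_sub, pderiv_zero_mon, Nat.add_sub_cancel, add_zero, sub_zero,
    show a + 2 - 1 = a + 1 from rfl]
  push_cast
  rfl

lemma refDiv_zero_mon (a b : ℕ) : refDiv ![mon a b, 0, 0] =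
    (((b : ℝ) + 1) • mon (a + 1) b - ((a : ℝ) + 1) • mon a (b + 1),
      -(((b : ℝ) + 1) • mon (a + 1) b - ((a : ℝ) + 1) • mon a (b + 1))) := by
  simp only [refDiv, LinearMap.coe_mk, AddHom.coe_mk, Matrix.cons_val, bubble_zero_mon, mul_zero,
    map_zero, pderiv_zero_mon, pderiv_one_mon, Nat.add_sub_cancel, zero_add, zero_sub]
  push_cast
  rfl

lemma vecSpace_le_of_mon {n : ℕ} {M : Submodule ℝ (MP × MP)}
    (h : ∀ a b, a + b ≤ n → (mon a b, (0 : MP)) ∈ M ∧ ((0 : MP), mon a b) ∈ M) :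
    vecSpace n ≤ M := by
  have h1 : restrictTotalDegree (Fin 2) ℝ n ≤ M.comap (LinearMap.inl ℝ MP MP) := by
    rw [restrictTotalDegree_eq_span, Submodule.span_le]
    rintro _ ⟨a, b, hab, rfl⟩
    exact (h a b hab).1
  have h2 : restrictTotalDegree (Fin 2) ℝ n ≤ M.comap (LinearMap.inr ℝ MP MP) := by
    rw [restrictTotalDegree_eq_span, Submodule.span_le]
    rintro _ ⟨a, b, hab, rfl⟩
    exact (h a b hab).2
  rintro ⟨p, q⟩ ⟨hp, hq⟩
  simpa using M.add_mem (h1 hp) (h2 hq)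

lemma mon_mem_sup (n : ℕ) : ∀ a b, a + b ≤ n + 1 →
    (mon a b, (0 : MP)) ∈ (coeffSpace n).map refDiv ⊔ LinearMap.range complMap ∧
    ((0 : MP), mon a b) ∈ (coeffSpace n).map refDiv ⊔ LinearMap.range complMap := by
  set M : ℕ → Submodule ℝ (MP × MP) :=
    fun n => (coeffSpace n).map refDiv ⊔ LinearMap.range complMap
  have hcompl : ∀ n c, complMap c ∈ M n := fun n c =>
    Submodule.mem_sup_right (LinearMap.mem_range_self _ _)
  have e00 : ∀ n, (mon 0 0, (0 : MP)) ∈ M n := fun n => by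
    simpa [complMap] using hcompl n ![1, 0, 0]
  have e10 : ∀ n, (mon 1 0, (0 : MP)) ∈ M n := fun n => by
    simpa [complMap] using hcompl n ![0, 1, 0]
  have f00 : ∀ n, ((0 : MP), mon 0 0) ∈ M n := fun n => by
    simpa [complMap] using hcompl n ![0, 0, 1]
  have rel : ∀ n (p : Fin 3 → MP), p ∈ coeffSpace n → (M n).mkQ (refDiv p) = 0 := fun n p hp =>
    (Submodule.Quotient.mk_eq_zero _).2 (Submodule.mem_sup_left ⟨p, hp, rfl⟩)
  have hmem : ∀ n a b, a + b = n → ![mon a b, 0, 0] ∈ coeffSpace n ∧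
      ![0, mon a b, 0] ∈ coeffSpace n ∧ ![0, 0, mon a b] ∈ coeffSpace n := by
    rintro n a b rfl
    simp [mem_coeffSpace, Fin.forall_fin_succ, mon_mem]
  have step : ∀ n, (∀ a b, a + b ≤ n → (mon a b, (0 : MP)) ∈ M n ∧ ((0 : MP), mon a b) ∈ M n) →
      ∀ a b, a + b = n →
      (((b : ℝ) + 1) • (M n).mkQ (mon (a + 1) b, 0) + ((b : ℝ) + 2) • (M n).mkQ (mon a (b + 1), 0) = 0
      ∧ ((a : ℝ) + 1) • (M n).mkQ (0, mon a (b + 1)) + ((a : ℝ) + 2) • (M n).mkQ (0, mon (a + 1) b) = 0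
      ∧ ((b : ℝ) + 1) • ((M n).mkQ (mon (a + 1) b, 0) - (M n).mkQ (0, mon (a + 1) b)) -
        ((a : ℝ) + 1) • ((M n).mkQ (mon a (b + 1), 0) - (M n).mkQ (0, mon a (b + 1))) = 0) := by
    intro n hlow a b hab
    obtain ⟨m0, m1, m2⟩ := hmem n a b hab
    have z1 : (M n).mkQ (mon a b, 0) = 0 := (Submodule.Quotient.mk_eq_zero _).2 (hlow a b hab.le).1
    have z2 : (M n).mkQ (0, mon a b) = 0 := (Submodule.Quotient.mk_eq_zero _).2 (hlow a b hab.le).2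
    have r0 := rel n _ m0
    have r1 := rel n _ m1
    have r2 := rel n _ m2
    rw [refDiv_zero_mon, show ((((b : ℝ) + 1) • mon (a + 1) b - ((a : ℝ) + 1) • mon a (b + 1),
      -(((b : ℝ) + 1) • mon (a + 1) b - ((a : ℝ) + 1) • mon a (b + 1))) : MP × MP) =
      ((b : ℝ) + 1) • ((mon (a + 1) b, 0) - (0, mon (a + 1) b)) -
        ((a : ℝ) + 1) • ((mon a (b + 1), 0) - (0, mon a (b + 1))) by
        refine Prod.ext (by simp) ?_
        simp
        abel] at r0
    rw [refDiv_one_mon, show ((((b : ℝ) + 1) • mon a b - ((b : ℝ) + 1) • mon (a + 1) b -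
      ((b : ℝ) + 2) • mon a (b + 1), 0) : MP × MP) = ((b : ℝ) + 1) • (mon a b, 0) -
      ((b : ℝ) + 1) • (mon (a + 1) b, 0) - ((b : ℝ) + 2) • (mon a (b + 1), 0) by
        ext1 <;> simp] at r1
    rw [refDiv_two_mon, show ((0, ((a : ℝ) + 1) • mon a b - ((a : ℝ) + 2) • mon (a + 1) b -
      ((a : ℝ) + 1) • mon a (b + 1)) : MP × MP) = ((a : ℝ) + 1) • (0, mon a b) -
      ((a : ℝ) + 2) • (0, mon (a + 1) b) - ((a : ℝ) + 1) • (0, mon a (b + 1)) by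
        ext1 <;> simp] at r2
    simp only [map_sub, map_smul, z1, z2, smul_zero] at r0 r1 r2
    refine ⟨?_, ?_, r0⟩
    · linear_combination (norm := module) (-1 : ℝ) • r1
    · linear_combination (norm := module) (-1 : ℝ) • r2
  have key : ∀ n a b, a + b ≤ n + 1 → (mon a b, (0 : MP)) ∈ M n ∧ ((0 : MP), mon a b) ∈ M n := by
    intro n
    induction n with
    | zero =>
      have hlow : ∀ a b, a + b ≤ 0 → (mon a b, (0 : MP)) ∈ M 0 ∧ ((0 : MP), mon a b) ∈ M 0 := by
        intro a b hab
        obtain ⟨rfl, rfl⟩ : a = 0 ∧ b = 0 := by omega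
        exact ⟨e00 0, f00 0⟩
      obtain ⟨r1, r2, r0⟩ := step 0 hlow 0 0 rfl
      have z : (M 0).mkQ (mon 1 0, 0) = 0 := (Submodule.Quotient.mk_eq_zero _).2 (e10 0)
      simp only [zero_add, Nat.cast_zero, one_smul, z] at r0 r1 r2
      have ze : (M 0).mkQ (mon 0 1, 0) = 0 := by linear_combination (norm := module) (1 / 2 : ℝ) • r1
      have zf : (M 0).mkQ (0, mon 1 0) = 0 := by
        rw [ze] at r0
        linear_combination (norm := module) (1 / 3 : ℝ) • (r2 - r0)
      have zf' : (M 0).mkQ (0, mon 0 1) = 0 := by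
        rw [zf] at r2
        linear_combination (norm := module) r2
      intro a b hab
      obtain ⟨rfl, rfl⟩ | ⟨rfl, rfl⟩ | ⟨rfl, rfl⟩ :
          (a = 0 ∧ b = 0) ∨ (a = 1 ∧ b = 0) ∨ (a = 0 ∧ b = 1) := by omega
      · exact ⟨e00 0, f00 0⟩
      · exact ⟨e10 0, (Submodule.Quotient.mk_eq_zero _).1 zf⟩
      · exact ⟨(Submodule.Quotient.mk_eq_zero _).1 ze, (Submodule.Quotient.mk_eq_zero _).1 zf'⟩
    | succ n ih =>
      have hmono : M n ≤ M (n + 1) :=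
        sup_le_sup_right (Submodule.map_mono (coeffSpace_mono n.le_succ)) _
      have hlow : ∀ a b, a + b ≤ n + 1 →
          (mon a b, (0 : MP)) ∈ M (n + 1) ∧ ((0 : MP), mon a b) ∈ M (n + 1) :=
        fun a b hab => ⟨hmono (ih a b hab).1, hmono (ih a b hab).2⟩
      intro a b hab
      rcases hab.lt_or_eq with hlt | heq
      · exact hlow a b (by omega)
      · have := top_degree_vanish (fun a b => (M (n + 1)).mkQ (mon a b, 0))
          (fun a b => (M (n + 1)).mkQ (0, mon a b)) (Nat.le_add_left 1 n)
          (fun a b h => (step _ hlow a b h).1) (fun a b h => (step _ hlow a b h).2.1)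
          (fun a b h => (step _ hlow a b h).2.2) heq
        exact ⟨(Submodule.Quotient.mk_eq_zero _).1 this.1,
          (Submodule.Quotient.mk_eq_zero _).1 this.2⟩
  exact key n

lemma finrank_map_refDiv (n : ℕ) :
    Module.finrank ℝ ((coeffSpace n).map refDiv) + 3 = (n + 2) * (n + 3) := by
  have hR : LinearMap.range complMap ≤ vecSpace (n + 1) := by
    rintro _ ⟨c, rfl⟩
    exact ⟨Submodule.add_mem _ (Submodule.smul_mem _ _ (mon_mem (by simp)))
      (Submodule.smul_mem _ _ (mon_mem (by simp))), Submodule.smul_mem _ _ (mon_mem (by simp))⟩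
  have hsup : (coeffSpace n).map refDiv ⊔ LinearMap.range complMap = vecSpace (n + 1) :=
    le_antisymm (sup_le (map_refDiv_le n) hR) (vecSpace_le_of_mon (mon_mem_sup n))
  have hinf : (coeffSpace n).map refDiv ⊓ LinearMap.range complMap = ⊥ := by
    rw [eq_bot_iff]
    rintro _ ⟨⟨p, _, rfl⟩, c, hc⟩
    rw [Submodule.mem_bot, ← hc, complMap_eq_zero hc.symm, map_zero]
  have := Submodule.finiteDimensional_of_le (map_refDiv_le n)
  have h := Submodule.finrank_sup_add_finrank_inf_eq ((coeffSpace n).map refDiv)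
    (LinearMap.range complMap)
  rw [hsup, hinf, finrank_bot, finrank_vecSpace,
    LinearMap.finrank_range_of_inj complMap_injective, Module.finrank_fin_fun] at h
  rw [← h]
  ring

/-! ### Affine changes of coordinates -/

/-- The affine polynomial `w 0 * x + w 1 * y + c`. -/
def affPoly (w : Fin 2 → ℝ) (c : ℝ) : MP := C (w 0) * X 0 + C (w 1) * X 1 + C c

lemma eval_affPoly (w : Fin 2 → ℝ) (c : ℝ) (x : Fin 2 → ℝ) :
    eval x (affPoly w c) = w 0 * x 0 + w 1 * x 1 + c := by
  simp [affPoly]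

lemma totalDegree_affPoly_le (w : Fin 2 → ℝ) (c : ℝ) : (affPoly w c).totalDegree ≤ 1 := by
  have hX (r : ℝ) (i : Fin 2) : (C r * X i : MP).totalDegree ≤ 1 :=
    (totalDegree_mul _ _).trans (by simp)
  refine (totalDegree_add _ _).trans (max_le ((totalDegree_add _ _).trans ?_) (by simp))
  exact max_le (hX _ _) (hX _ _)

lemma totalDegree_aeval_le {l : Fin 2 → MP} (hl : ∀ i, (l i).totalDegree ≤ 1) {n : ℕ} {q : MP}
    (hq : q.totalDegree ≤ n) : (aeval l q).totalDegree ≤ n := by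
  rw [← mem_restrictTotalDegree, restrictTotalDegree_eq_span] at hq
  rw [← mem_restrictTotalDegree]
  induction hq using Submodule.span_induction with
  | mem x hx =>
    obtain ⟨a, b, hab, rfl⟩ := hx
    rw [mem_restrictTotalDegree]
    simp only [mon, map_mul, map_pow, aeval_X]
    calc (l 0 ^ a * l 1 ^ b).totalDegree
        ≤ (l 0 ^ a).totalDegree + (l 1 ^ b).totalDegree := totalDegree_mul _ _
      _ ≤ a * (l 0).totalDegree + b * (l 1).totalDegree :=
        add_le_add (totalDegree_pow _ _) (totalDegree_pow _ _)
      _ ≤ a * 1 + b * 1 := by gcongr <;> exact hl _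
      _ ≤ n := by simpa using hab
  | zero => simp
  | add x y _ _ hx hy => rw [map_add]; exact Submodule.add_mem _ hx hy
  | smul c x _ hx => rw [map_smul]; exact Submodule.smul_mem _ _ hx

lemma eval_aeval (l : Fin 2 → MP) (q : MP) (x : Fin 2 → ℝ) :
    eval x (aeval l q) = eval (fun i => eval x (l i)) q := by
  induction q using MvPolynomial.induction_on with
  | C a => simp
  | add p q hp hq => rw [map_add, map_add, map_add, hp, hq]
  | mul_X p i hp => rw [map_mul, map_mul, map_mul, hp, aeval_X, eval_X]

lemma hasFDerivAt_eval {f g : (Fin 2 → ℝ) → ℝ} {f' g' : (Fin 2 → ℝ) →L[ℝ] ℝ} {x : Fin 2 → ℝ}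
    (hf : HasFDerivAt f f' x) (hg : HasFDerivAt g g' x) (q : MP) :
    HasFDerivAt (fun y => eval ![f y, g y] q)
      (eval ![f x, g x] (pderiv 0 q) • f' + eval ![f x, g x] (pderiv 1 q) • g') x := by
  induction q using MvPolynomial.induction_on with
  | C a => simpa using hasFDerivAt_const a x
  | add p q hp hq =>
    simp only [map_add]
    refine (hp.add hq).congr_fderiv ?_
    module
  | mul_X p i hp =>
    have hX : HasFDerivAt (fun y => eval ![f y, g y] (X i : MP))
        (eval ![f x, g x] (pderiv 0 (X i : MP)) • f' +
          eval ![f x, g x] (pderiv 1 (X i : MP)) • g') x := by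
      fin_cases i
      · simpa [pderiv_X_of_ne] using hf
      · simpa [pderiv_X_of_ne] using hg
    simp only [map_mul]
    refine (hp.mul hX).congr_fderiv ?_
    simp only [Derivation.leibniz, smul_eq_mul, map_add, map_mul]
    module

lemma hasFDerivAt_affine (w : Fin 2 → ℝ) (c : ℝ) (x : Fin 2 → ℝ) :
    HasFDerivAt (fun y : Fin 2 → ℝ => w 0 * y 0 + w 1 * y 1 + c)
      (w 0 • ContinuousLinearMap.proj (R := ℝ) (φ := fun _ : Fin 2 => ℝ) 0 +
        w 1 • ContinuousLinearMap.proj (R := ℝ) (φ := fun _ : Fin 2 => ℝ) 1) x :=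
  ((((ContinuousLinearMap.proj (R := ℝ) (φ := fun _ : Fin 2 => ℝ) 0).hasFDerivAt).const_mul _).add
    (((ContinuousLinearMap.proj (R := ℝ) (φ := fun _ : Fin 2 => ℝ) 1).hasFDerivAt).const_mul
      _)).add_const _

lemma pd_eval {w₁ w₂ : Fin 2 → ℝ} {c₁ c₂ : ℝ} {f g : (Fin 2 → ℝ) → ℝ}
    (hf : ∀ x, f x = w₁ 0 * x 0 + w₁ 1 * x 1 + c₁)
    (hg : ∀ x, g x = w₂ 0 * x 0 + w₂ 1 * x 1 + c₂) (m : Fin 2) (q : MP) (x : Fin 2 → ℝ) :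
    pd m (fun y => eval ![f y, g y] q) x =
      eval ![f x, g x] (pderiv 0 q) * w₁ m + eval ![f x, g x] (pderiv 1 q) * w₂ m := by
  obtain rfl : f = _ := funext hf
  obtain rfl : g = _ := funext hg
  rw [pd, (hasFDerivAt_eval (hasFDerivAt_affine w₁ c₁ x) (hasFDerivAt_affine w₂ c₂ x) q).fderiv]
  fin_cases m <;> simp

/-- The vector field with components `f`, `g` in the tangent basis, after the change of
coordinates `x ↦ (l₁ x, l₂ x)`. -/
def toField (l₁ l₂ : (Fin 2 → ℝ) → ℝ) (t₁ t₂ : Fin 2 → ℝ) :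
    MP × MP →ₗ[ℝ] ((Fin 2 → ℝ) → Fin 2 → ℝ) where
  toFun p x := eval ![l₁ x, l₂ x] p.1 • t₁ - eval ![l₁ x, l₂ x] p.2 • t₂
  map_add' p q := by
    funext x
    simp only [Prod.fst_add, Prod.snd_add, map_add, Pi.add_apply]
    module
  map_smul' c p := by
    funext x
    simp only [Prod.smul_fst, Prod.smul_snd, smul_eval, RingHom.id_apply, Pi.smul_apply]
    module

lemma toField_injective {l₁ l₂ : (Fin 2 → ℝ) → ℝ} {t₁ t₂ : Fin 2 → ℝ}
    (hl : ∀ u : Fin 2 → ℝ, ∃ x, ![l₁ x, l₂ x] = u) (ht : t₁ 0 * t₂ 1 - t₁ 1 * t₂ 0 ≠ 0) :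
    Function.Injective (toField l₁ l₂ t₁ t₂) := by
  refine (injective_iff_map_eq_zero _).2 fun p hp => ?_
  have h : ∀ u, eval u p.1 = 0 ∧ eval u p.2 = 0 := by
    intro u
    obtain ⟨x, rfl⟩ := hl u
    have h0 := congrFun (congrFun hp x) 0
    have h1 := congrFun (congrFun hp x) 1
    simp only [toField, LinearMap.coe_mk, AddHom.coe_mk, Pi.sub_apply, Pi.smul_apply, smul_eq_mul,
      Pi.zero_apply] at h0 h1
    constructor
    · refine (mul_eq_zero.1 ?_).resolve_right ht
      linear_combination t₂ 1 * h0 - t₂ 0 * h1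
    · refine (mul_eq_zero.1 ?_).resolve_right ht
      linear_combination t₁ 1 * h0 - t₁ 0 * h1
  exact Prod.ext (MvPolynomial.funext fun u => by simpa using (h u).1)
    (MvPolynomial.funext fun u => by simpa using (h u).2)

lemma matDiv_bubbleStress {x0 x1 x2 : Fin 2 → ℝ} {lam : Fin 3 → (Fin 2 → ℝ) → ℝ}
    {c₁ c₂ : ℝ}
    (h1 : ∀ x, lam 1 x = nvec x0 x1 x2 1 0 * x 0 + nvec x0 x1 x2 1 1 * x 1 + c₁)
    (h2 : ∀ x, lam 2 x = nvec x0 x1 x2 2 0 * x 0 + nvec x0 x1 x2 2 1 * x 1 + c₂)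
    (h0 : ∀ x, lam 0 x = 1 - lam 1 x - lam 2 x) (q : Fin 3 → MP) :
    matDiv (bubbleStress x0 x1 x2 lam fun i x => eval ![lam 1 x, lam 2 x] (q i)) =
      (nvec x0 x1 x2 1 0 * nvec x0 x1 x2 2 1 - nvec x0 x1 x2 1 1 * nvec x0 x1 x2 2 0) •
        toField (lam 1) (lam 2) (perp (nvec x0 x1 x2 1)) (perp (nvec x0 x1 x2 2)) (refDiv q) := by
  have hn : nvec x0 x1 x2 0 = fun j => -nvec x0 x1 x2 1 j - nvec x0 x1 x2 2 j := rfl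
  have hentry : ∀ i j, (fun y => bubbleStress x0 x1 x2 lam
      (fun i x => eval ![lam 1 x, lam 2 x] (q i)) y i j) = fun y => eval ![lam 1 y, lam 2 y]
      (C (vvT (perp (nvec x0 x1 x2 1)) i j) * (X 1 * (1 - X 0 - X 1) * q 1) +
       C (vvT (perp (nvec x0 x1 x2 2)) i j) * (X 0 * (1 - X 0 - X 1) * q 2) +
       C (vvT (perp (nvec x0 x1 x2 0)) i j) * (X 0 * X 1 * q 0)) := by
    intro i j
    funext y
    simp only [bubbleStress, h0, Matrix.add_apply, Matrix.smul_apply, smul_eq_mul, map_add,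
      map_mul, map_sub, map_one, eval_C, eval_X, Matrix.cons_val]
    ring
  funext x i
  rw [matDiv, hentry, hentry, pd_eval h1 h2, pd_eval h1 h2, hn]
  generalize nvec x0 x1 x2 1 = w₁
  generalize nvec x0 x1 x2 2 = w₂
  simp only [toField, refDiv, LinearMap.coe_mk, AddHom.coe_mk, map_add, map_sub, map_mul,
    pderiv_C_mul, eval_C, Pi.smul_apply, Pi.sub_apply, smul_eq_mul]
  fin_cases i <;> simp [vvT, perp] <;> ring

/-! ### Barycentric coordinates -/

lemma exists_barycentric {x0 x1 x2 : Fin 2 → ℝ} {lam : Fin 3 → (Fin 2 → ℝ) → ℝ}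
    (haff : ∀ i, IsAffineFn (lam i))
    (hval : ∀ i j : Fin 3, lam i (![x0, x1, x2] j) = if i = j then 1 else 0) :
    (∃ c, ∀ x, lam 1 x = nvec x0 x1 x2 1 0 * x 0 + nvec x0 x1 x2 1 1 * x 1 + c) ∧
    (∃ c, ∀ x, lam 2 x = nvec x0 x1 x2 2 0 * x 0 + nvec x0 x1 x2 2 1 * x 1 + c) ∧
    (∀ x, lam 0 x = 1 - lam 1 x - lam 2 x) ∧
    nvec x0 x1 x2 1 0 * nvec x0 x1 x2 2 1 - nvec x0 x1 x2 1 1 * nvec x0 x1 x2 2 0 ≠ 0 ∧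
    (∀ x j, x j = (x1 j - x0 j) * lam 1 x + (x2 j - x0 j) * lam 2 x + x0 j) ∧
    ∀ u : Fin 2 → ℝ, ∃ x, ![lam 1 x, lam 2 x] = u := by
  obtain ⟨w₀, c₀, h0⟩ := haff 0
  obtain ⟨w₁, c₁, h1⟩ := haff 1
  obtain ⟨w₂, c₂, h2⟩ := haff 2
  have v00 : lam 0 x0 = 1 := (hval 0 0).trans (if_pos rfl)
  have v01 : lam 0 x1 = 0 := (hval 0 1).trans (if_neg (by decide))
  have v02 : lam 0 x2 = 0 := (hval 0 2).trans (if_neg (by decide))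
  have v10 : lam 1 x0 = 0 := (hval 1 0).trans (if_neg (by decide))
  have v11 : lam 1 x1 = 1 := (hval 1 1).trans (if_pos rfl)
  have v12 : lam 1 x2 = 0 := (hval 1 2).trans (if_neg (by decide))
  have v20 : lam 2 x0 = 0 := (hval 2 0).trans (if_neg (by decide))
  have v21 : lam 2 x1 = 0 := (hval 2 1).trans (if_neg (by decide))
  have v22 : lam 2 x2 = 1 := (hval 2 2).trans (if_pos rfl)
  rw [h0] at v00 v01 v02
  rw [h1] at v10 v11 v12
  rw [h2] at v20 v21 v22
  have hWB : Matrix.of ![w₁, w₂] * Bmat x0 x1 x2 = 1 := by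
    ext i j
    fin_cases i <;> fin_cases j <;> simp [Matrix.mul_apply, Fin.sum_univ_two, Bmat] <;> linarith
  have hBW := mul_eq_one_comm.1 hWB
  have hinv := Matrix.inv_eq_left_inv hWB
  have n1 : nvec x0 x1 x2 1 = w₁ := by
    funext j; simp [nvec, hinv]
  have n2 : nvec x0 x1 x2 2 = w₂ := by
    funext j; simp [nvec, hinv]
  have hdet : w₁ 0 * w₂ 1 - w₁ 1 * w₂ 0 ≠ 0 := by
    have := congrArg Matrix.det hWB
    rw [Matrix.det_mul, Matrix.det_one, Matrix.det_fin_two] at this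
    exact left_ne_zero_of_mul_eq_one this
  have b00 := congrFun (congrFun hBW 0) 0
  have b01 := congrFun (congrFun hBW 0) 1
  have b10 := congrFun (congrFun hBW 1) 0
  have b11 := congrFun (congrFun hBW 1) 1
  simp [Matrix.mul_apply, Fin.sum_univ_two, Bmat] at b00 b01 b10 b11
  have hcoord : ∀ x j, x j = (x1 j - x0 j) * lam 1 x + (x2 j - x0 j) * lam 2 x + x0 j := by
    intro x j
    rw [h1, h2]
    fin_cases j
    · simp only [Fin.zero_eta]
      linear_combination (-(x 0 - x0 0)) * b00 - (x 1 - x0 1) * b01 - (x1 0 - x0 0) * v10 -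
        (x2 0 - x0 0) * v20
    · simp only [Fin.mk_one]
      linear_combination (-(x 0 - x0 0)) * b10 - (x 1 - x0 1) * b11 - (x1 1 - x0 1) * v10 -
        (x2 1 - x0 1) * v20
  rw [n1, n2]
  refine ⟨⟨c₁, h1⟩, ⟨c₂, h2⟩, ?_, hdet, hcoord, ?_⟩
  · intro x
    have e0 := hcoord x 0
    have e1 := hcoord x 1
    rw [h0]
    linear_combination w₀ 0 * e0 + w₀ 1 * e1 + (1 - lam 1 x - lam 2 x) * v00 + lam 1 x * v01 +
      lam 2 x * v02
  · intro u
    refine ⟨fun j => (x1 j - x0 j) * u 0 + (x2 j - x0 j) * u 1 + x0 j, ?_⟩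
    ext i
    fin_cases i
    · simp only [h1, Fin.zero_eta, Matrix.cons_val]
      linear_combination (1 - u 0 - u 1) * v10 + u 0 * v11 + u 1 * v12
    · simp only [h2, Fin.mk_one, Matrix.cons_val]
      linear_combination (1 - u 0 - u 1) * v20 + u 0 * v21 + u 1 * v22

lemma isPolyDeg_natCast_iff {n : ℕ} {f : (Fin 2 → ℝ) → ℝ} :
    IsPolyDeg n f ↔ ∃ p : MP, p.totalDegree ≤ n ∧ ∀ x, f x = eval x p := by
  constructor
  · rintro ⟨p, hp, hdeg | rfl⟩
    · exact ⟨p, by exact_mod_cast hdeg, hp⟩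
    · exact ⟨0, by simp, hp⟩
  · rintro ⟨p, hdeg, hp⟩
    exact ⟨p, hp, Or.inl (by exact_mod_cast hdeg)⟩

lemma isPolyDeg_comp_iff {x0 x1 x2 : Fin 2 → ℝ} {l₁ l₂ : (Fin 2 → ℝ) → ℝ} {w₁ w₂ : Fin 2 → ℝ}
    {c₁ c₂ : ℝ} (h1 : ∀ x, l₁ x = w₁ 0 * x 0 + w₁ 1 * x 1 + c₁)
    (h2 : ∀ x, l₂ x = w₂ 0 * x 0 + w₂ 1 * x 1 + c₂)
    (hcoord : ∀ x j, x j = (x1 j - x0 j) * l₁ x + (x2 j - x0 j) * l₂ x + x0 j)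
    {n : ℕ} {f : (Fin 2 → ℝ) → ℝ} :
    IsPolyDeg n f ↔ ∃ q : MP, q.totalDegree ≤ n ∧ f = fun x => eval ![l₁ x, l₂ x] q := by
  rw [isPolyDeg_natCast_iff]
  constructor
  · rintro ⟨p, hdeg, hp⟩
    refine ⟨aeval (fun j => affPoly ![x1 j - x0 j, x2 j - x0 j] (x0 j)) p,
      totalDegree_aeval_le (fun _ => totalDegree_affPoly_le _ _) hdeg, ?_⟩
    funext x
    have hx : x = fun j => eval ![l₁ x, l₂ x]
        (affPoly ![x1 j - x0 j, x2 j - x0 j] (x0 j)) := by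
      funext j
      rw [eval_affPoly]
      exact hcoord x j
    rw [hp, eval_aeval]
    exact congrArg (fun y => eval y p) hx
  · rintro ⟨q, hdeg, rfl⟩
    refine ⟨aeval ![affPoly w₁ c₁, affPoly w₂ c₂] q, totalDegree_aeval_le ?_ hdeg, fun x => ?_⟩
    · intro i
      fin_cases i <;> exact totalDegree_affPoly_le _ _
    · have hx : ![l₁ x, l₂ x] = fun i => eval x (![affPoly w₁ c₁, affPoly w₂ c₂] i) := by
        funext i
        fin_cases i
        · exact (h1 x).trans (eval_affPoly w₁ c₁ x).symm
        · exact (h2 x).trans (eval_affPoly w₂ c₂ x).symm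
      rw [eval_aeval]
      exact congrArg (fun y => eval y q) hx

end BubbleDiv

open BubbleDiv in
theorem stmt_14 (k : ℕ) (hk : 3 ≤ k)
    (x0 x1 x2 : Fin 2 → ℝ)
    (hind : AffineIndependent ℝ ![x0, x1, x2])
    (lam : Fin 3 → (Fin 2 → ℝ) → ℝ)
    (hlam_aff : ∀ i, IsAffineFn (lam i))
    (hlam_val : ∀ i j : Fin 3, lam i (![x0, x1, x2] j) = if i = j then 1 else 0) :
    Module.finrank ℝ
      (Submodule.span ℝ {v | ∃ τ, SigmaKb k x0 x1 x2 lam τ ∧ matDiv τ = v}) =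
      k ^ 2 + k - 3 := by
  obtain ⟨n, rfl⟩ : ∃ n, k = n + 2 := ⟨k - 2, by omega⟩
  obtain ⟨⟨c₁, h1⟩, ⟨c₂, h2⟩, h0, hdet, hcoord, hsurj⟩ :=
    exists_barycentric hlam_aff hlam_val
  set d := nvec x0 x1 x2 1 0 * nvec x0 x1 x2 2 1 - nvec x0 x1 x2 1 1 * nvec x0 x1 x2 2 0 with hd
  set Φ := d • toField (lam 1) (lam 2) (perp (nvec x0 x1 x2 1)) (perp (nvec x0 x1 x2 2))
  have hpoly := fun f => isPolyDeg_comp_iff h1 h2 hcoord (n := n) (f := f)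
  have hset : {v | ∃ τ, SigmaKb (n + 2) x0 x1 x2 lam τ ∧ matDiv τ = v} =
      (((coeffSpace n).map refDiv).map Φ : Set ((Fin 2 → ℝ) → Fin 2 → ℝ)) := by
    have hcast : ((n + 2 : ℕ) : ℤ) - 2 = n := by push_cast; ring
    ext v
    constructor
    · rintro ⟨_, ⟨p, hp, rfl⟩, rfl⟩
      rw [hcast] at hp
      choose q hq hpq using fun i => (hpoly _).1 (hp i)
      obtain rfl : p = _ := funext hpq
      exact ⟨refDiv q, ⟨q, mem_coeffSpace.2 fun i =>
        (MvPolynomial.mem_restrictTotalDegree _ _ _).2 (hq i), rfl⟩,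
        (matDiv_bubbleStress h1 h2 h0 q).symm⟩
    · rintro ⟨_, ⟨q, hq, rfl⟩, rfl⟩
      refine ⟨_, ⟨fun i x => MvPolynomial.eval ![lam 1 x, lam 2 x] (q i), fun i => ?_, rfl⟩,
        matDiv_bubbleStress h1 h2 h0 q⟩
      rw [hcast]
      exact (hpoly _).2 ⟨q i, (MvPolynomial.mem_restrictTotalDegree _ _ _).1
        (mem_coeffSpace.1 hq i), rfl⟩
  have hinj : Function.Injective Φ := by
    refine (smul_right_injective _ hdet).comp (toField_injective hsurj ?_)
    simp only [perp, Matrix.cons_val]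
    intro h
    exact hdet (by rw [hd]; linear_combination h)
  have hrank := finrank_map_refDiv n
  rw [hset, Submodule.span_eq, ← (Submodule.equivMapOfInjective Φ hinj _).finrank_eq]
  have : (n + 2) ^ 2 + (n + 2) = (n + 2) * (n + 3) := by ring
  omega
end
end
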